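/- Let E be a closed real-linear subspace of S₂(H) with [X, [X, Y]] ∈ E for all X, Y ∈ E, and let F = E^⊥ be the orthogonal complement of E in S₂(H) with respect to the Hilbert–Schmidt inner product. If p ∈ P and q ∈ exp E satisfies d(p, q) = inf{ d(p, e) : e ∈ exp E }, then q^{−1/2} p q^{−1/2} ∈ exp F; i.e., the geodesic from p to its projection q meets exp E orthogonally. -/

import Mathlib

noncomputable section

open scoped InnerProductSpace

variable {H : Type*} [NormedAddCommGroup H] [InnerProductSpace ℂ H] [CompleteSpace H]
variable {ι : Type*}

/-- `A` is a Hilbert–Schmidt operator (w.r.t. the Hilbert basis `e`). -/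
def IsHS (e : HilbertBasis ι ℂ H) (A : H →L[ℂ] H) : Prop :=
  Summable fun i => ‖A (e i)‖ ^ 2

/-- The Hilbert–Schmidt norm of `A` (w.r.t. the Hilbert basis `e`). -/
def hsNorm (e : HilbertBasis ι ℂ H) (A : H →L[ℂ] H) : ℝ :=
  Real.sqrt (∑' i, ‖A (e i)‖ ^ 2)

/-- The real Hilbert–Schmidt inner product `⟨A, B⟩₂ = ∑ ⟪A eᵢ, B eᵢ⟫`. -/
def hsInner (e : HilbertBasis ι ℂ H) (A B : H →L[ℂ] H) : ℝ :=
  (∑' i, (inner ℂ (A (e i)) (B (e i)) : ℂ)).re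

/-- The trace of an operator, `Tr T = ∑ ⟪eᵢ, T eᵢ⟫`. -/
def opTrace (e : HilbertBasis ι ℂ H) (T : H →L[ℂ] H) : ℂ :=
  ∑' i, (inner ℂ (e i) (T (e i)) : ℂ)

/-- `T` is trace class: it is the product of two Hilbert–Schmidt operators. -/
def IsTraceClass (e : HilbertBasis ι ℂ H) (T : H →L[ℂ] H) : Prop :=
  ∃ B C : H →L[ℂ] H, IsHS e B ∧ IsHS e C ∧ T = B * C

/-- `A ∈ S₂(H)`: self-adjoint and Hilbert–Schmidt. -/
def MemS2 (e : HilbertBasis ι ℂ H) (A : H →L[ℂ] H) : Prop :=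
  IsSelfAdjoint A ∧ IsHS e A

/-- `p ∈ P`: self-adjoint, positive definite (invertible and `⟪p x, x⟫ ≥ 0`),
with `p - 1` Hilbert–Schmidt. -/
def MemP (e : HilbertBasis ι ℂ H) (p : H →L[ℂ] H) : Prop :=
  IsSelfAdjoint p ∧ IsUnit p ∧ (∀ x : H, 0 ≤ (inner ℂ (p x) x : ℂ).re) ∧ IsHS e (p - 1)

/-- `x ∈ GL₂(H)`: invertible with `x - 1` Hilbert–Schmidt. -/
def MemGL2 (e : HilbertBasis ι ℂ H) (x : H →L[ℂ] H) : Prop :=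
  IsUnit x ∧ IsHS e (x - 1)

/-- `x ∈ U₂(H)`: unitary with `x - 1` Hilbert–Schmidt. -/
def MemU2 (e : HilbertBasis ι ℂ H) (x : H →L[ℂ] H) : Prop :=
  x ∈ unitary (H →L[ℂ] H) ∧ IsHS e (x - 1)

/-- `p^{1/2}`, via continuous functional calculus. -/
def psqrt (p : H →L[ℂ] H) : H →L[ℂ] H := cfc Real.sqrt p

/-- `p^{-1/2}`, via continuous functional calculus. -/
def pinvsqrt (p : H →L[ℂ] H) : H →L[ℂ] H := cfc (fun t : ℝ => (Real.sqrt t)⁻¹) p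

/-- `log p`, via continuous functional calculus. -/
def plog (p : H →L[ℂ] H) : H →L[ℂ] H := cfc Real.log p

/-- The geodesic distance `d(p, q) = ‖log (p^{-1/2} q p^{-1/2})‖₂`. -/
def gdist (e : HilbertBasis ι ℂ H) (p q : H →L[ℂ] H) : ℝ :=
  hsNorm e (plog (pinvsqrt p * q * pinvsqrt p))

/-- The commutator `[A, B] = AB - BA`. -/
def brk (A B : H →L[ℂ] H) : H →L[ℂ] H := A * B - B * A

/-- The constant-speed geodesic `t ↦ p^{1/2} exp(t K) p^{1/2}`. -/
def geoCurve (p K : H →L[ℂ] H) (t : ℝ) : H →L[ℂ] H :=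
  psqrt p * NormedSpace.exp (t • K) * psqrt p

/-- The geodesic from `p` to `q`:
`t ↦ p^{1/2} exp(t log(p^{-1/2} q p^{-1/2})) p^{1/2}`. -/
def geodesic (p q : H →L[ℂ] H) (t : ℝ) : H →L[ℂ] H :=
  geoCurve p (plog (pinvsqrt p * q * pinvsqrt p)) t

/-- The image `exp E` of a set of operators under the exponential map. -/
def expSet (E : Set (H →L[ℂ] H)) : Set (H →L[ℂ] H) := NormedSpace.exp '' E

/-- The orthogonal complement of `E` inside `S₂(H)` for the Hilbert–Schmidt
inner product. -/
def hsPerp (e : HilbertBasis ι ℂ H) (E : Set (H →L[ℂ] H)) : Set (H →L[ℂ] H) :=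
  {Y | MemS2 e Y ∧ ∀ X ∈ E, hsInner e X Y = 0}

/-- `E` is closed in `S₂(H)` with respect to the Hilbert–Schmidt norm. -/
def IsHSClosed (e : HilbertBasis ι ℂ H) (E : Set (H →L[ℂ] H)) : Prop :=
  ∀ X : H →L[ℂ] H, MemS2 e X → (∀ ε > (0:ℝ), ∃ Y ∈ E, hsNorm e (X - Y) < ε) → X ∈ E

set_option linter.unusedSectionVars false

/-- Real Hilbert space model of the Hilbert–Schmidt operators. -/
def HSV (ι H : Type*) [NormedAddCommGroup H] : Type _ := lp (fun _ : ι => H) 2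

instance HSV.instNACG : NormedAddCommGroup (HSV ι H) :=
  inferInstanceAs (NormedAddCommGroup (lp (fun _ : ι => H) 2))

instance HSV.instIPS : InnerProductSpace ℝ (HSV ι H) :=
  InnerProductSpace.complexToReal (G := lp (fun _ : ι => H) 2)

instance HSV.instComplete : CompleteSpace (HSV ι H) :=
  inferInstanceAs (CompleteSpace (lp (fun _ : ι => H) 2))

/-- coordinates -/
def HSV.co (v : HSV ι H) (i : ι) : H := (show lp (fun _ : ι => H) 2 from v) i

lemma HSV.ext' {v w : HSV ι H} (h : ∀ i, v.co i = w.co i) : v = w :=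
  Subtype.ext (funext h)

lemma HSV.co_add (v w : HSV ι H) (i : ι) : (v + w).co i = v.co i + w.co i := rfl

lemma HSV.co_smul (c : ℝ) (v : HSV ι H) (i : ι) : (c • v).co i = c • v.co i := rfl

lemma HSV.hasSum_inner (v w : HSV ι H) :
    HasSum (fun i => (inner ℂ (v.co i) (w.co i) : ℂ).re) (inner ℝ v w) :=
  Complex.hasSum_re
    (lp.hasSum_inner (𝕜 := ℂ) (v : lp (fun _ : ι => H) 2) (w : lp (fun _ : ι => H) 2))

lemma HSV.hasSum_norm_sq (v : HSV ι H) : HasSum (fun i => ‖v.co i‖ ^ 2) (‖v‖ ^ 2) := by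
  have h := HSV.hasSum_inner v v
  rw [real_inner_self_eq_norm_sq] at h
  convert h using 2 with i
  rw [inner_self_eq_norm_sq_to_K]
  norm_cast

lemma memlp_of_summable {f : ι → H} (h : Summable fun i => ‖f i‖ ^ 2) :
    Memℓp f 2 := by
  apply memℓp_gen
  simpa using h

/-- construct an element from a square summable family -/
def HSV.mk (f : ι → H) (h : Summable fun i => ‖f i‖ ^ 2) : HSV ι H :=
  (⟨f, memlp_of_summable h⟩ : lp (fun _ : ι => H) 2)

lemma HSV.co_mk (f : ι → H) (h : Summable fun i => ‖f i‖ ^ 2) (i : ι) :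
    (HSV.mk f h).co i = f i := rfl

lemma HSV.norm_mk_le (f : ι → H) (h : Summable fun i => ‖f i‖ ^ 2) (C : ℝ) (hC : 0 ≤ C)
    (h2 : ∑' i, ‖f i‖ ^ 2 ≤ C ^ 2) : ‖HSV.mk f h‖ ≤ C := by
  have := (HSV.hasSum_norm_sq (HSV.mk f h)).tsum_eq
  simp only [HSV.co_mk] at this
  rw [this] at h2
  exact (sq_le_sq₀ (norm_nonneg _) hC).1 h2

lemma basis_hasSum_sq (e : HilbertBasis ι ℂ H) (x : H) :
    HasSum (fun i => ‖(inner ℂ (e i) x : ℂ)‖ ^ 2) (‖x‖ ^ 2) := by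
  have h := e.hasSum_inner_mul_inner x x
  have h2 := Complex.hasSum_re h
  convert h2 using 1
  · funext i
    rw [← inner_conj_symm x (e i), Complex.conj_mul']
    norm_cast
  · rw [inner_self_eq_norm_sq_to_K]
    norm_cast

lemma hsT_summable (e : HilbertBasis ι ℂ H) (v : HSV ι H) (x : H) :
    Summable (fun i => ‖(inner ℂ (e i) x : ℂ) • v.co i‖) ∧
      ∑' i, ‖(inner ℂ (e i) x : ℂ) • v.co i‖ ≤ ‖x‖ * ‖v‖ := by
  have := Real.summable_and_inner_le_Lp_mul_Lq_tsum_of_nonneg (p := 2) (q := 2)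
    (f := fun i => ‖(inner ℂ (e i) x : ℂ)‖) (g := fun i => ‖v.co i‖)
    ⟨by norm_num, by norm_num, by norm_num⟩ (fun _ => norm_nonneg _) (fun _ => norm_nonneg _)
    (by simpa using (basis_hasSum_sq e x).summable) (by simpa using v.hasSum_norm_sq.summable)
  simp only [norm_smul]
  refine ⟨this.1, this.2.trans (le_of_eq ?_)⟩
  simp only [Real.rpow_two]
  rw [(basis_hasSum_sq e x).tsum_eq, v.hasSum_norm_sq.tsum_eq, ← Real.sqrt_eq_rpow,
    ← Real.sqrt_eq_rpow, Real.sqrt_sq (norm_nonneg _), Real.sqrt_sq (norm_nonneg _)]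

/-- the operator attached to an element of `HSV` -/
def hsTop (e : HilbertBasis ι ℂ H) (v : HSV ι H) : H →L[ℂ] H :=
  LinearMap.mkContinuous
    { toFun := fun x => ∑' i, (inner ℂ (e i) x : ℂ) • v.co i
      map_add' := fun x y => by
        rw [← ((hsT_summable e v x).1.of_norm).tsum_add ((hsT_summable e v y).1.of_norm)]
        simp only [inner_add_right, add_smul]
      map_smul' := fun c x => by
        rw [RingHom.id_apply, ← ((hsT_summable e v x).1.of_norm).tsum_const_smul]
        simp only [inner_smul_right, mul_smul] } ‖v‖
    (fun x => by
      rw [mul_comm]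
      exact (norm_tsum_le_tsum_norm (hsT_summable e v x).1).trans (hsT_summable e v x).2)

lemma hsTop_apply (e : HilbertBasis ι ℂ H) (v : HSV ι H) (x : H) :
    hsTop e v x = ∑' i, (inner ℂ (e i) x : ℂ) • v.co i := rfl

lemma hsTop_norm_le (e : HilbertBasis ι ℂ H) (v : HSV ι H) : ‖hsTop e v‖ ≤ ‖v‖ :=
  ContinuousLinearMap.opNorm_le_bound _ (norm_nonneg _) fun x => by
    rw [mul_comm, hsTop_apply]
    exact (norm_tsum_le_tsum_norm (hsT_summable e v x).1).trans (hsT_summable e v x).2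

lemma hsTop_basis (e : HilbertBasis ι ℂ H) (v : HSV ι H) (i : ι) :
    hsTop e v (e i) = v.co i := by
  classical
  rw [hsTop_apply, tsum_eq_single i]
  · rw [orthonormal_iff_ite.1 e.orthonormal i i]
    simp
  · intro j hj
    simp [orthonormal_iff_ite.1 e.orthonormal j i, hj]

lemma op_ext (e : HilbertBasis ι ℂ H) {A B : H →L[ℂ] H} (h : ∀ i, A (e i) = B (e i)) : A = B := by
  apply ContinuousLinearMap.ext_on (s := Set.range e)
  · have := e.dense_span
    rw [Submodule.dense_iff_topologicalClosure_eq_top]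
    exact this
  · rintro _ ⟨i, rfl⟩
    exact h i

/-- the operator attached to an element of `HSV`, as a continuous linear map -/
def hsT (e : HilbertBasis ι ℂ H) : HSV ι H →L[ℝ] (H →L[ℂ] H) :=
  LinearMap.mkContinuous
    { toFun := hsTop e
      map_add' := fun v w => op_ext e fun i => by
        simp only [hsTop_basis, add_apply, HSV.co_add]
      map_smul' := fun c v => op_ext e fun i => by
        simp only [hsTop_basis, smul_apply, HSV.co_smul, RingHom.id_apply] } 1
    (fun v => by
      rw [one_mul]
      exact hsTop_norm_le e v)

lemma hsT_basis (e : HilbertBasis ι ℂ H) (v : HSV ι H) (i : ι) :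
    hsT e v (e i) = v.co i := hsTop_basis e v i

lemma hsT_norm_le (e : HilbertBasis ι ℂ H) (v : HSV ι H) : ‖hsT e v‖ ≤ ‖v‖ :=
  hsTop_norm_le e v

lemma hsT_inj (e : HilbertBasis ι ℂ H) {v w : HSV ι H} (h : hsT e v = hsT e w) : v = w :=
  HSV.ext' fun i => by rw [← hsT_basis e, h, hsT_basis]

lemma hsT_isHS (e : HilbertBasis ι ℂ H) (v : HSV ι H) : IsHS e (hsT e v) := by
  unfold IsHS
  simp only [hsT_basis]
  exact v.hasSum_norm_sq.summable

/-- a Hilbert–Schmidt operator as an element of `HSV` -/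
def toV (e : HilbertBasis ι ℂ H) (A : H →L[ℂ] H) (hA : IsHS e A) : HSV ι H :=
  HSV.mk (fun i => A (e i)) hA

lemma hsT_toV (e : HilbertBasis ι ℂ H) (A : H →L[ℂ] H) (hA : IsHS e A) :
    hsT e (toV e A hA) = A := op_ext e fun i => by rw [hsT_basis]; rfl

lemma hsNorm_hsT (e : HilbertBasis ι ℂ H) (v : HSV ι H) : hsNorm e (hsT e v) = ‖v‖ := by
  unfold hsNorm
  simp only [hsT_basis, v.hasSum_norm_sq.tsum_eq]
  exact Real.sqrt_sq (norm_nonneg _)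

lemma hsInner_hsT (e : HilbertBasis ι ℂ H) (v w : HSV ι H) :
    hsInner e (hsT e v) (hsT e w) = inner ℝ v w := by
  unfold hsInner
  simp only [hsT_basis]
  rfl

lemma isHS_iff_enn (e : HilbertBasis ι ℂ H) (A : H →L[ℂ] H) :
    IsHS e A ↔ ∑' i, ENNReal.ofReal (‖A (e i)‖ ^ 2) ≠ ⊤ := by
  constructor
  · intro h
    exact h.tsum_ofReal_ne_top
  · intro h
    have := ENNReal.summable_toReal h
    simp only [ENNReal.toReal_ofReal (sq_nonneg _)] at this
    exact this

lemma enn_adjoint (e : HilbertBasis ι ℂ H) (A : H →L[ℂ] H) :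
    ∑' i, ENNReal.ofReal (‖A (e i)‖ ^ 2) = ∑' i, ENNReal.ofReal (‖(star A) (e i)‖ ^ 2) := by
  have key : ∀ y : H, ENNReal.ofReal (‖y‖ ^ 2)
      = ∑' j, ENNReal.ofReal (‖(inner ℂ (e j) y : ℂ)‖ ^ 2) := by
    intro y
    rw [← (basis_hasSum_sq e y).tsum_eq]
    exact ENNReal.ofReal_tsum_of_nonneg (fun _ => sq_nonneg _) (basis_hasSum_sq e y).summable
  simp only [key (A _), key (star A _)]
  rw [ENNReal.tsum_comm]
  refine tsum_congr fun j => tsum_congr fun i => ?_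
  rw [ContinuousLinearMap.star_eq_adjoint, ContinuousLinearMap.adjoint_inner_right,
    ← inner_conj_symm, RCLike.norm_conj]

lemma IsHS.star {e : HilbertBasis ι ℂ H} {A : H →L[ℂ] H} (hA : IsHS e A) : IsHS e (star A) := by
  rw [isHS_iff_enn, ← enn_adjoint, ← isHS_iff_enn]
  exact hA

lemma tsum_adjoint (e : HilbertBasis ι ℂ H) (A : H →L[ℂ] H) :
    ∑' i, (‖A (e i)‖ ^ 2) = ∑' i, (‖(star A) (e i)‖ ^ 2) := by
  have := congrArg ENNReal.toReal (enn_adjoint e A)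
  rw [ENNReal.tsum_toReal_eq (fun _ => ENNReal.ofReal_ne_top),
    ENNReal.tsum_toReal_eq (fun _ => ENNReal.ofReal_ne_top)] at this
  simpa only [ENNReal.toReal_ofReal (sq_nonneg _)] using this

lemma hsNorm_star (e : HilbertBasis ι ℂ H) (A : H →L[ℂ] H) :
    hsNorm e (star A) = hsNorm e A := by
  unfold hsNorm
  rw [tsum_adjoint e A]

set_option linter.unusedSectionVars false

lemma IsHS.mul_left {e : HilbertBasis ι ℂ H} (A : H →L[ℂ] H) {B : H →L[ℂ] H} (hB : IsHS e B) :
    IsHS e (A * B) := by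
  unfold IsHS at *
  refine Summable.of_nonneg_of_le (fun _ => sq_nonneg _) (fun i => ?_) (hB.mul_left (‖A‖ ^ 2))
  rw [← mul_pow]
  exact pow_le_pow_left₀ (norm_nonneg _) (A.le_opNorm _) 2

lemma hsNorm_mul_left_le {e : HilbertBasis ι ℂ H} (A : H →L[ℂ] H) {B : H →L[ℂ] H}
    (hB : IsHS e B) : hsNorm e (A * B) ≤ ‖A‖ * hsNorm e B := by
  unfold hsNorm
  rw [Real.sqrt_le_left (by positivity), mul_pow, Real.sq_sqrt (tsum_nonneg fun _ => sq_nonneg _),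
    ← tsum_mul_left]
  refine Summable.tsum_le_tsum (fun i => ?_) (IsHS.mul_left A hB) (Summable.mul_left (‖A‖ ^ 2) hB)
  rw [← mul_pow]
  exact pow_le_pow_left₀ (norm_nonneg _) (A.le_opNorm _) 2

lemma IsHS.mul_right {e : HilbertBasis ι ℂ H} (A : H →L[ℂ] H) {B : H →L[ℂ] H} (hB : IsHS e B) :
    IsHS e (B * A) := by
  have := IsHS.star (IsHS.mul_left (Star.star A) (IsHS.star hB))
  simpa using this

lemma hsNorm_mul_right_le {e : HilbertBasis ι ℂ H} (A : H →L[ℂ] H) {B : H →L[ℂ] H}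
    (hB : IsHS e B) : hsNorm e (B * A) ≤ ‖A‖ * hsNorm e B := by
  have := hsNorm_mul_left_le (star A) hB.star
  rw [← hsNorm_star, star_mul]
  rwa [hsNorm_star e B, norm_star] at this

lemma norm_toV (e : HilbertBasis ι ℂ H) (A : H →L[ℂ] H) (hA : IsHS e A) :
    ‖toV e A hA‖ = hsNorm e A := by
  rw [← hsNorm_hsT e, hsT_toV]

/-- left multiplication -/
def Lm (e : HilbertBasis ι ℂ H) : (H →L[ℂ] H) →L[ℝ] HSV ι H →L[ℝ] HSV ι H :=
  LinearMap.mkContinuous₂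
    (LinearMap.mk₂ ℝ (fun A v => toV e (A * hsT e v) ((hsT_isHS e v).mul_left A))
      (fun A B v => hsT_inj e (by simp only [map_add, hsT_toV, add_mul]))
      (fun c A v => hsT_inj e (by simp only [map_smul, hsT_toV, smul_mul_assoc]))
      (fun A v w => hsT_inj e (by simp only [map_add, hsT_toV, mul_add]))
      (fun c A v => hsT_inj e (by simp only [map_smul, hsT_toV, mul_smul_comm]))) 1
    (fun A v => by
      rw [one_mul, LinearMap.mk₂_apply, norm_toV, ← hsNorm_hsT e v]
      exact hsNorm_mul_left_le A (hsT_isHS e v))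

/-- right multiplication -/
def Rm (e : HilbertBasis ι ℂ H) : (H →L[ℂ] H) →L[ℝ] HSV ι H →L[ℝ] HSV ι H :=
  LinearMap.mkContinuous₂
    (LinearMap.mk₂ ℝ (fun A v => toV e (hsT e v * A) ((hsT_isHS e v).mul_right A))
      (fun A B v => hsT_inj e (by simp only [map_add, hsT_toV, mul_add]))
      (fun c A v => hsT_inj e (by simp only [map_smul, hsT_toV, mul_smul_comm]))
      (fun A v w => hsT_inj e (by simp only [map_add, hsT_toV, add_mul]))
      (fun c A v => hsT_inj e (by simp only [map_smul, hsT_toV, smul_mul_assoc]))) 1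
    (fun A v => by
      rw [one_mul, LinearMap.mk₂_apply, norm_toV, ← hsNorm_hsT e v]
      exact hsNorm_mul_right_le A (hsT_isHS e v))

lemma hsT_Lm (e : HilbertBasis ι ℂ H) (A : H →L[ℂ] H) (v : HSV ι H) :
    hsT e (Lm e A v) = A * hsT e v := hsT_toV e _ ((hsT_isHS e v).mul_left A)

lemma hsT_Rm (e : HilbertBasis ι ℂ H) (A : H →L[ℂ] H) (v : HSV ι H) :
    hsT e (Rm e A v) = hsT e v * A := hsT_toV e _ ((hsT_isHS e v).mul_right A)

lemma norm_Lm_le (e : HilbertBasis ι ℂ H) (A : H →L[ℂ] H) (v : HSV ι H) :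
    ‖Lm e A v‖ ≤ ‖A‖ * ‖v‖ := by
  rw [← hsNorm_hsT e, hsT_Lm, ← hsNorm_hsT e v]
  exact hsNorm_mul_left_le A (hsT_isHS e v)

lemma norm_Rm_le (e : HilbertBasis ι ℂ H) (A : H →L[ℂ] H) (v : HSV ι H) :
    ‖Rm e A v‖ ≤ ‖A‖ * ‖v‖ := by
  rw [← hsNorm_hsT e, hsT_Rm, ← hsNorm_hsT e v]
  exact hsNorm_mul_right_le A (hsT_isHS e v)

/-- adjoint as a real isometry -/
def hsJ (e : HilbertBasis ι ℂ H) : HSV ι H →ₗᵢ[ℝ] HSV ι H where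
  toFun v := toV e (star (hsT e v)) (hsT_isHS e v).star
  map_add' v w := hsT_inj e (by simp only [map_add, hsT_toV, star_add])
  map_smul' c v := hsT_inj e (by
    simp only [map_smul, hsT_toV, RingHom.id_apply, star_smul, star_trivial])
  norm_map' v := by
    change ‖toV e (star (hsT e v)) (hsT_isHS e v).star‖ = ‖v‖
    rw [norm_toV, hsNorm_star, hsNorm_hsT]

lemma hsT_hsJ (e : HilbertBasis ι ℂ H) (v : HSV ι H) : hsT e (hsJ e v) = star (hsT e v) :=
  hsT_toV e _ (hsT_isHS e v).star

lemma inner_Lm (e : HilbertBasis ι ℂ H) (A : H →L[ℂ] H) (v w : HSV ι H) :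
    inner ℝ (Lm e A v) w = inner ℝ v (Lm e (star A) w) := by
  have h1 := (HSV.hasSum_inner (Lm e A v) w)
  have h2 := (HSV.hasSum_inner v (Lm e (star A) w))
  refine h1.unique ?_
  convert h2 using 2 with i
  rw [← hsT_basis e, ← hsT_basis e, ← hsT_basis e, ← hsT_basis e, hsT_Lm, hsT_Lm]
  change _ = (inner ℂ (hsT e v (e i)) ((star A) (hsT e w (e i)))).re
  rw [ContinuousLinearMap.star_eq_adjoint, ContinuousLinearMap.adjoint_inner_right]
  rfl

lemma hsJ_Rm (e : HilbertBasis ι ℂ H) (A : H →L[ℂ] H) (v : HSV ι H) :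
    hsJ e (Rm e A v) = Lm e (star A) (hsJ e v) := by
  apply hsT_inj e
  simp only [hsT_hsJ, hsT_Rm, hsT_Lm, star_mul]

lemma inner_Rm (e : HilbertBasis ι ℂ H) (A : H →L[ℂ] H) (v w : HSV ι H) :
    inner ℝ (Rm e A v) w = inner ℝ v (Rm e (star A) w) := by
  rw [← (hsJ e).inner_map_map, hsJ_Rm, inner_Lm, ← hsJ_Rm, (hsJ e).inner_map_map]

/-- Duhamel integral -/
def Duh (e : HilbertBasis ι ℂ H) (A B : H →L[ℂ] H) (z : HSV ι H) : HSV ι H :=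
  ∫ s in (0:ℝ)..1, Lm e (NormedSpace.exp ((1 - s) • A)) (Rm e (NormedSpace.exp (s • B)) z)

section abstractAlg

variable {𝔸 : Type*} [NormedRing 𝔸] [NormedAlgebra ℝ 𝔸] [CompleteSpace 𝔸]

lemma aexp_cont : Continuous (NormedSpace.exp : 𝔸 → 𝔸) :=
  letI : NormedAlgebra ℚ 𝔸 := NormedAlgebra.restrictScalars ℚ ℝ 𝔸
  NormedSpace.exp_continuous

lemma aexp_add {x y : 𝔸} (h : Commute x y) :
    NormedSpace.exp (x + y) = NormedSpace.exp x * NormedSpace.exp y :=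
  letI : NormedAlgebra ℚ 𝔸 := NormedAlgebra.restrictScalars ℚ ℝ 𝔸
  NormedSpace.exp_add_of_commute h

lemma aexp_smul_mul (x : 𝔸) (a b : ℝ) :
    NormedSpace.exp (a • x) * NormedSpace.exp (b • x) = NormedSpace.exp ((a + b) • x) := by
  rw [add_smul, aexp_add ((Commute.refl x).smul_left a |>.smul_right b)]

lemma aexp_hasDeriv (A B : 𝔸) (s : ℝ) : HasDerivAt
    (fun s : ℝ => NormedSpace.exp ((1 - s) • A) * NormedSpace.exp (s • B))
    (NormedSpace.exp ((1 - s) • A) * ((B - A) * NormedSpace.exp (s • B))) s := by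
  have h1 : HasDerivAt (fun s : ℝ => NormedSpace.exp ((1 - s) • A))
      (-(NormedSpace.exp ((1 - s) • A) * A)) s := by
    have := (hasDerivAt_exp_smul_const (𝕂 := ℝ) A (1 - s)).scomp s
      ((hasDerivAt_id s).const_sub 1)
    rw [neg_one_smul] at this
    exact this
  have h2 := hasDerivAt_exp_smul_const' (𝕂 := ℝ) B s
  have h3 := h1.mul h2
  have h4 : NormedSpace.exp ((1 - s) • A) * ((B - A) * NormedSpace.exp (s • B)) =
      -(NormedSpace.exp ((1 - s) • A) * A) * NormedSpace.exp (s • B) +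
        NormedSpace.exp ((1 - s) • A) * (B * NormedSpace.exp (s • B)) := by
    simp only [sub_mul, mul_sub, neg_mul, mul_assoc]
    abel
  rw [h4]
  exact h3

lemma aexp_integral (A B : 𝔸) :
    ∫ s in (0:ℝ)..1, NormedSpace.exp ((1 - s) • A) * ((B - A) * NormedSpace.exp (s • B))
      = NormedSpace.exp B - NormedSpace.exp A := by
  rw [intervalIntegral.integral_eq_sub_of_hasDerivAt (fun s _ => aexp_hasDeriv A B s)]
  · simp
  · apply Continuous.intervalIntegrable
    have := aexp_cont (𝔸 := 𝔸)
    fun_prop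

end abstractAlg

lemma cont_exp : Continuous (NormedSpace.exp : (H →L[ℂ] H) → (H →L[ℂ] H)) :=
  aexp_cont

lemma Duh_cont_integrand (e : HilbertBasis ι ℂ H) (A B : H →L[ℂ] H) (z : HSV ι H) :
    Continuous fun s : ℝ =>
      Lm e (NormedSpace.exp ((1 - s) • A)) (Rm e (NormedSpace.exp (s • B)) z) := by
  have := cont_exp (H := H)
  fun_prop

lemma hsT_Duh (e : HilbertBasis ι ℂ H) (A B : H →L[ℂ] H) (z : HSV ι H) (hz : hsT e z = B - A) :
    hsT e (Duh e A B z) = NormedSpace.exp B - NormedSpace.exp A := by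
  unfold Duh
  rw [← ContinuousLinearMap.intervalIntegral_comp_comm _
    ((Duh_cont_integrand e A B z).intervalIntegrable _ _)]
  simp only [hsT_Lm, hsT_Rm, hz]
  exact aexp_integral A B

lemma Duh_smul (e : HilbertBasis ι ℂ H) (A B : H →L[ℂ] H) (c : ℝ) (z : HSV ι H) :
    Duh e A B (c • z) = c • Duh e A B z := by
  unfold Duh
  simp only [map_smul]
  exact intervalIntegral.integral_smul _ _

lemma Duh_cont (e : HilbertBasis ι ℂ H) (A : H →L[ℂ] H) (B : ℝ → (H →L[ℂ] H))
    (hB : Continuous B) (z : HSV ι H) : Continuous fun t => Duh e A (B t) z := by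
  unfold Duh
  apply intervalIntegral.continuous_parametric_intervalIntegral_of_continuous'
  have := cont_exp (H := H)
  unfold Function.uncurry
  fun_prop

lemma exp_sa {Y : H →L[ℂ] H} (hY : IsSelfAdjoint Y) : IsSelfAdjoint (NormedSpace.exp Y) :=
  hY.exp

lemma plog_exp {Y : H →L[ℂ] H} (hY : IsSelfAdjoint Y) : plog (NormedSpace.exp Y) = Y :=
  CFC.log_exp Y hY

lemma pinvsqrt_exp {Y : H →L[ℂ] H} (hY : IsSelfAdjoint Y) :
    pinvsqrt (NormedSpace.exp Y) = NormedSpace.exp (-(1/2 : ℝ) • Y) := by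
  have h1 : IsSelfAdjoint (-(1/2 : ℝ) • Y) := (IsSelfAdjoint.all _).smul hY
  rw [← CFC.real_exp_eq_normedSpace_exp (a := -(1/2 : ℝ) • Y) h1,
    ← CFC.real_exp_eq_normedSpace_exp (a := Y) hY]
  unfold pinvsqrt
  have hc : ContinuousOn (fun t : ℝ => (Real.sqrt t)⁻¹) (Real.exp '' spectrum ℝ Y) := by
    apply ContinuousOn.inv₀
    · exact Real.continuous_sqrt.continuousOn
    · rintro _ ⟨x, -, rfl⟩
      exact (Real.sqrt_pos.2 (Real.exp_pos x)).ne'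
  rw [← cfc_comp (fun t : ℝ => (Real.sqrt t)⁻¹) Real.exp Y hY hc Real.continuous_exp.continuousOn]
  rw [← cfc_comp_smul (-(1/2 : ℝ)) Real.exp Y Real.continuous_exp.continuousOn hY]
  congr 1
  funext x
  simp only [Function.comp, smul_eq_mul]
  rw [← Real.exp_half, ← Real.exp_neg]
  congr 1
  ring

lemma IsHS.add {e : HilbertBasis ι ℂ H} {A B : H →L[ℂ] H} (hA : IsHS e A) (hB : IsHS e B) :
    IsHS e (A + B) := by
  rw [← hsT_toV e A hA, ← hsT_toV e B hB, ← map_add]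
  exact hsT_isHS e _

lemma IsHS.sub {e : HilbertBasis ι ℂ H} {A B : H →L[ℂ] H} (hA : IsHS e A) (hB : IsHS e B) :
    IsHS e (A - B) := by
  rw [← hsT_toV e A hA, ← hsT_toV e B hB, ← map_sub]
  exact hsT_isHS e _

lemma IsHS.smul {e : HilbertBasis ι ℂ H} {A : H →L[ℂ] H} (hA : IsHS e A) (c : ℝ) :
    IsHS e (c • A) := by
  rw [← hsT_toV e A hA, ← map_smul]
  exact hsT_isHS e _

lemma exp_sub_one_isHS {e : HilbertBasis ι ℂ H} {A : H →L[ℂ] H} (hA : IsHS e A) :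
    IsHS e (NormedSpace.exp A - 1) := by
  have := hsT_Duh e 0 A (toV e A hA) (by rw [hsT_toV, sub_zero])
  rw [NormedSpace.exp_zero] at this
  rw [← this]
  exact hsT_isHS e _

lemma spectrum_pos_of {r : H →L[ℂ] H} (h : IsStrictlyPositive r) :
    ∀ x ∈ spectrum ℝ r, 0 < x := by
  intro x hx
  exact h.spectrum_pos hx

lemma plog_isHS {e : HilbertBasis ι ℂ H} {r : H →L[ℂ] H} (h : IsStrictlyPositive r)
    (hr : IsHS e (r - 1)) : IsHS e (plog r) := by
  have hsp := spectrum_pos_of h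
  have hsa : IsSelfAdjoint r := h.isSelfAdjoint
  have hd : ContinuousOn (dslope Real.log 1) (spectrum ℝ r) := by
    have : ContinuousOn (dslope Real.log 1) (Set.Ioi 0) := by
      rw [continuousOn_dslope (Ioi_mem_nhds one_pos)]
      refine ⟨Real.continuousOn_log.mono ?_, Real.differentiableAt_log one_ne_zero⟩
      intro x hx
      exact ne_of_gt hx
    exact this.mono hsp
  have key : plog r = cfc (dslope Real.log 1) r * (r - 1) := by
    have h1 : r - 1 = cfc (fun x : ℝ => x - 1) r := by
      rw [cfc_sub (fun x : ℝ => x) (fun _ => 1) r, cfc_id' ℝ r, cfc_const_one ℝ r]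
    rw [h1, ← cfc_mul _ _ r hd (by fun_prop)]
    unfold plog
    apply cfc_congr
    intro x hx
    have := sub_smul_dslope Real.log 1 x
    simp only [smul_eq_mul, Real.log_one, sub_zero] at this
    simp only
    rw [mul_comm, this]
  rw [key]
  exact hr.mul_left _

lemma MemP.strictlyPositive {e : HilbertBasis ι ℂ H} {p : H →L[ℂ] H} (hp : MemP e p) :
    IsStrictlyPositive p := by
  obtain ⟨h1, h2, h3, h4⟩ := hp
  refine h2.isStrictlyPositive ?_
  rw [ContinuousLinearMap.nonneg_iff_isPositive, ContinuousLinearMap.isPositive_def]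
  refine ⟨h1.isSymmetric, fun x => ?_⟩
  exact h3 x

lemma plog_sa (r : H →L[ℂ] H) : IsSelfAdjoint (plog r) := cfc_predicate _ _

lemma exp_plog {r : H →L[ℂ] H} (h : IsStrictlyPositive r) : NormedSpace.exp (plog r) = r :=
  CFC.exp_log r h

lemma exp_strictlyPositive {Y : H →L[ℂ] H} (hY : IsSelfAdjoint Y) :
    IsStrictlyPositive (NormedSpace.exp Y) := by
  have : IsUnit (NormedSpace.exp Y) := by
    let _ : NormedAlgebra ℚ (H →L[ℂ] H) := NormedAlgebra.restrictScalars ℚ ℂ _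
    exact NormedSpace.isUnit_exp Y
  exact this.isStrictlyPositive hY.exp_nonneg

lemma conj_strictlyPositive {a r : H →L[ℂ] H} (hr : IsStrictlyPositive r) (ha : IsUnit a)
    (hsa : IsSelfAdjoint a) : IsStrictlyPositive (a * r * a) := by
  refine IsUnit.isStrictlyPositive ((ha.mul hr.isUnit).mul ha) ?_
  have := star_left_conjugate_nonneg hr.nonneg a
  rwa [hsa.star_eq] at this

lemma exp_unit (Y : H →L[ℂ] H) : IsUnit (NormedSpace.exp Y) := by
  let _ : NormedAlgebra ℚ (H →L[ℂ] H) := NormedAlgebra.restrictScalars ℚ ℂ _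
  exact NormedSpace.isUnit_exp Y

lemma Lm_mul (e : HilbertBasis ι ℂ H) (A B : H →L[ℂ] H) (v : HSV ι H) :
    Lm e (A * B) v = Lm e A (Lm e B v) :=
  hsT_inj e (by simp only [hsT_Lm, mul_assoc])

lemma Rm_mul (e : HilbertBasis ι ℂ H) (A B : H →L[ℂ] H) (v : HSV ι H) :
    Rm e (A * B) v = Rm e B (Rm e A v) :=
  hsT_inj e (by simp only [hsT_Rm, mul_assoc])

lemma Lm_one (e : HilbertBasis ι ℂ H) (v : HSV ι H) : Lm e 1 v = v :=
  hsT_inj e (by simp only [hsT_Lm, one_mul])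

lemma Rm_one (e : HilbertBasis ι ℂ H) (v : HSV ι H) : Rm e 1 v = v :=
  hsT_inj e (by simp only [hsT_Rm, mul_one])

lemma Lm_Rm (e : HilbertBasis ι ℂ H) (A B : H →L[ℂ] H) (v : HSV ι H) :
    Lm e A (Rm e B v) = Rm e B (Lm e A v) :=
  hsT_inj e (by simp only [hsT_Rm, hsT_Lm, mul_assoc])

lemma op_exp_smul_mul (x : H →L[ℂ] H) (a b : ℝ) :
    NormedSpace.exp (a • x) * NormedSpace.exp (b • x) = NormedSpace.exp ((a + b) • x) :=
  aexp_smul_mul x a b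

lemma norm_op_one_le : ‖(1 : H →L[ℂ] H)‖ ≤ 1 := ContinuousLinearMap.norm_id_le

lemma norm_op_exp_le (x : H →L[ℂ] H) : ‖NormedSpace.exp x‖ ≤ Real.exp ‖x‖ := by
  let _ : NormedAlgebra ℚ (H →L[ℂ] H) := NormedAlgebra.restrictScalars ℚ ℂ _
  have h1 := NormedSpace.exp_series_hasSum_exp' (𝕂 := ℝ) x
  have h2 := NormedSpace.exp_series_hasSum_exp' (𝕂 := ℝ) ‖x‖
  rw [← Real.exp_eq_exp_ℝ] at h2
  rw [← h1.tsum_eq]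
  refine tsum_of_norm_bounded h2 fun n => ?_
  rw [norm_smul, smul_eq_mul]
  have h3 : ‖((Nat.factorial n : ℝ))⁻¹‖ = ((Nat.factorial n : ℝ))⁻¹ := by
    rw [Real.norm_of_nonneg]; positivity
  rw [h3]
  refine mul_le_mul_of_nonneg_left ?_ (by positivity)
  rcases Nat.eq_zero_or_pos n with rfl | hn
  · simpa using norm_op_one_le (H := H)
  · exact norm_pow_le' x hn

lemma norm_exp_smul_le (x : H →L[ℂ] H) (c d : ℝ) (h : |c| ≤ d) :
    ‖NormedSpace.exp (c • x)‖ ≤ Real.exp (d * ‖x‖) := by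
  refine (norm_op_exp_le _).trans (Real.exp_le_exp.2 ?_)
  rw [norm_smul]
  exact mul_le_mul_of_nonneg_right h (norm_nonneg _)

lemma exp_smul_sa {x : H →L[ℂ] H} (hx : IsSelfAdjoint x) (c : ℝ) :
    star (NormedSpace.exp (c • x)) = NormedSpace.exp (c • x) :=
  (exp_sa ((IsSelfAdjoint.all c).smul hx)).star_eq

lemma inner_Duh_integrand (e : HilbertBasis ι ℂ H) {A B : H →L[ℂ] H} (hA : IsSelfAdjoint A)
    (hB : IsSelfAdjoint B) (a b : ℝ) (z : HSV ι H) :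
    inner ℝ z (Lm e (NormedSpace.exp (a • A)) (Rm e (NormedSpace.exp (b • B)) z)) =
      ‖Lm e (NormedSpace.exp ((a / 2) • A)) (Rm e (NormedSpace.exp ((b / 2) • B)) z)‖ ^ 2 := by
  rw [← real_inner_self_eq_norm_sq, inner_Lm, inner_Rm, exp_smul_sa hA, exp_smul_sa hB,
    ← Lm_mul, ← Lm_Rm, ← Rm_mul, op_exp_smul_mul, op_exp_smul_mul]
  rw [add_halves, add_halves]

lemma Duh_lower (e : HilbertBasis ι ℂ H) {A B : H →L[ℂ] H} (hA : IsSelfAdjoint A)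
    (hB : IsSelfAdjoint B) (z : HSV ι H) :
    Real.exp (-(‖A‖ + ‖B‖)) * ‖z‖ ^ 2 ≤ inner ℝ z (Duh e A B z) := by
  have hint := (Duh_cont_integrand e A B z)
  have h1 : inner ℝ z (Duh e A B z) = ∫ s in (0:ℝ)..1, inner ℝ z
      (Lm e (NormedSpace.exp ((1 - s) • A)) (Rm e (NormedSpace.exp (s • B)) z)) := by
    unfold Duh
    exact ((innerSL ℝ z).intervalIntegral_comp_comm (hint.intervalIntegrable _ _)).symm
  rw [h1]
  have h2 : Real.exp (-(‖A‖ + ‖B‖)) * ‖z‖ ^ 2 =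
      ∫ _ in (0:ℝ)..1, Real.exp (-(‖A‖ + ‖B‖)) * ‖z‖ ^ 2 := by simp
  rw [h2]
  refine intervalIntegral.integral_mono_on zero_le_one (by simp)
    (Continuous.intervalIntegrable (by fun_prop) _ _) fun s hs => ?_
  rw [inner_Duh_integrand e hA hB]
  set w := Lm e (NormedSpace.exp (((1 - s) / 2) • A)) (Rm e (NormedSpace.exp ((s / 2) • B)) z)
    with hw
  have hz : z = Lm e (NormedSpace.exp ((-((1 - s) / 2)) • A))
      (Rm e (NormedSpace.exp ((-(s / 2)) • B)) w) := by
    rw [hw, ← Lm_Rm, ← Rm_mul, ← Lm_mul, op_exp_smul_mul, op_exp_smul_mul]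
    simp only [neg_add_cancel, add_neg_cancel, zero_smul, NormedSpace.exp_zero, Lm_one, Rm_one]
  have hn : ‖z‖ ≤ Real.exp (1/2 * ‖A‖) * (Real.exp (1/2 * ‖B‖) * ‖w‖) := by
    conv_lhs => rw [hz]
    refine (norm_Lm_le e _ _).trans ?_
    refine mul_le_mul (norm_exp_smul_le _ _ _ ?_) ((norm_Rm_le e _ _).trans ?_)
      (norm_nonneg _) (Real.exp_pos _).le
    · rw [abs_le]; constructor <;> linarith [hs.1, hs.2]
    · refine mul_le_mul_of_nonneg_right (norm_exp_smul_le _ _ _ ?_) (norm_nonneg _)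
      rw [abs_le]; constructor <;> linarith [hs.1, hs.2]
  have hn2 : ‖z‖ ^ 2 ≤ Real.exp (‖A‖ + ‖B‖) * ‖w‖ ^ 2 := by
    refine (pow_le_pow_left₀ (norm_nonneg _) hn 2).trans (le_of_eq ?_)
    rw [← mul_assoc, ← Real.exp_add, mul_pow, ← Real.exp_nat_mul]
    congr 2
    push_cast; ring
  rw [Real.exp_neg]
  rw [inv_mul_le_iff₀ (Real.exp_pos _)]
  exact hn2

/-- auxiliary integral -/
def Nint (e : HilbertBasis ι ℂ H) (A B : H →L[ℂ] H) (z : HSV ι H) : HSV ι H :=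
  ∫ s in (0:ℝ)..1, Lm e (NormedSpace.exp ((-s) • A)) (Rm e (NormedSpace.exp (s • B)) z)

lemma Nint_cont_integrand (e : HilbertBasis ι ℂ H) (A B : H →L[ℂ] H) (z : HSV ι H) :
    Continuous fun s : ℝ =>
      Lm e (NormedSpace.exp ((-s) • A)) (Rm e (NormedSpace.exp (s • B)) z) := by
  have := cont_exp (H := H)
  fun_prop

lemma Nint_cont (e : HilbertBasis ι ℂ H) (A : H →L[ℂ] H) (z : HSV ι H) :
    Continuous fun B => Nint e A B z := by
  unfold Nint
  apply intervalIntegral.continuous_parametric_intervalIntegral_of_continuous'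
  have := cont_exp (H := H)
  unfold Function.uncurry
  fun_prop

lemma op_exp_comm (A : H →L[ℂ] H) (c : ℝ) :
    A * NormedSpace.exp (c • A) = NormedSpace.exp (c • A) * A := by
  let _ : NormedAlgebra ℚ (H →L[ℂ] H) := NormedAlgebra.restrictScalars ℚ ℂ _
  exact (((Commute.refl A).smul_right c).exp_right).eq

lemma Nint_self (e : HilbertBasis ι ℂ H) (z : HSV ι H) : Nint e (hsT e z) (hsT e z) z = z := by
  unfold Nint
  have : ∀ s : ℝ, Lm e (NormedSpace.exp ((-s) • hsT e z))
      (Rm e (NormedSpace.exp (s • hsT e z)) z) = z := by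
    intro s
    apply hsT_inj e
    rw [hsT_Lm, hsT_Rm, op_exp_comm, ← mul_assoc, op_exp_smul_mul]
    simp
  simp only [this]
  simp

lemma Nint_inner_aux (e : HilbertBasis ι ℂ H) (A F G : H →L[ℂ] H) (hF : star F = F)
    (hG : star G = G) (w z : HSV ι H) :
    inner ℝ (Lm e A w) (Lm e F (Rm e G z)) = inner ℝ z (Lm e (F * A) (Rm e G w)) := by
  rw [real_inner_comm, inner_Lm, inner_Rm, hF, hG, ← Lm_mul, Lm_Rm]

lemma Nint_inner (e : HilbertBasis ι ℂ H) {A B : H →L[ℂ] H} (hA : IsSelfAdjoint A)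
    (hB : IsSelfAdjoint B) (w z : HSV ι H) :
    inner ℝ (Lm e (NormedSpace.exp ((-1 : ℝ) • A)) w) (Duh e A B z)
      = inner ℝ (Nint e A B w) z := by
  rw [real_inner_comm z]
  unfold Duh Nint
  have h1 := (innerSL ℝ (Lm e (NormedSpace.exp ((-1 : ℝ) • A)) w)).intervalIntegral_comp_comm
    ((Duh_cont_integrand e A B z).intervalIntegrable (μ := MeasureTheory.volume) 0 1)
  have h2 := (innerSL ℝ z).intervalIntegral_comp_comm
    ((Nint_cont_integrand e A B w).intervalIntegrable (μ := MeasureTheory.volume) 0 1)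
  simp only [innerSL_apply_apply] at h1 h2
  rw [← h1, ← h2]
  congr 1
  funext s
  rw [Nint_inner_aux e _ _ _ (exp_smul_sa hA _) (exp_smul_sa hB _), op_exp_smul_mul]
  rw [show (1 - s + -1) = -s by ring]

lemma variation (e : HilbertBasis ι ℂ H) (l : ℝ → HSV ι H)
    (hsa : ∀ t, IsSelfAdjoint (hsT e (l t)))
    (hcont : ContinuousAt (fun t => hsT e (l t)) 0) (D : ℝ → HSV ι H) (hD : ContinuousAt D 0)
    (hexp : ∀ t, NormedSpace.exp (hsT e (l t)) - NormedSpace.exp (hsT e (l 0)) = t • hsT e (D t))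
    (hmin : ∀ t, ‖l 0‖ ≤ ‖l t‖) :
    0 ≤ inner ℝ (Lm e (NormedSpace.exp ((-1 : ℝ) • hsT e (l 0))) (l 0)) (D 0) := by
  set g := Lm e (NormedSpace.exp ((-1 : ℝ) • hsT e (l 0))) (l 0) with hg
  have hDuh : ∀ t, Duh e (hsT e (l 0)) (hsT e (l t)) (l t - l 0) = t • D t := fun t =>
    hsT_inj e (by rw [hsT_Duh e _ _ _ (map_sub _ _ _), hexp, map_smul])
  let C : ℝ → ℝ := fun t => Real.exp (‖hsT e (l 0)‖ + ‖hsT e (l t)‖)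
  let N : ℝ → HSV ι H := fun t => Nint e (hsT e (l 0)) (hsT e (l t)) (l 0)
  have hΔ : ∀ t, 0 ≤ t → ‖l t - l 0‖ ≤ C t * (t * ‖D t‖) := by
    intro t ht
    have h1 := Duh_lower e (hsa 0) (hsa t) (l t - l 0)
    rw [hDuh, Real.exp_neg, inv_mul_le_iff₀ (Real.exp_pos _)] at h1
    have h2 : inner ℝ (l t - l 0) (t • D t) ≤ ‖l t - l 0‖ * (t * ‖D t‖) := by
      refine (real_inner_le_norm _ _).trans (le_of_eq ?_)
      rw [norm_smul, Real.norm_of_nonneg ht]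
    have h3 : ‖l t - l 0‖ * ‖l t - l 0‖ ≤ ‖l t - l 0‖ * (C t * (t * ‖D t‖)) := by
      rw [← pow_two]
      refine h1.trans ?_
      have := mul_le_mul_of_nonneg_left h2 (Real.exp_pos (‖hsT e (l 0)‖ + ‖hsT e (l t)‖)).le
      refine this.trans (le_of_eq ?_)
      ring
    rcases (norm_nonneg (l t - l 0)).eq_or_lt with h | h
    · rw [← h]; positivity
    · exact le_of_mul_le_mul_left h3 h
  let f : ℝ → ℝ := fun t => 2 * inner ℝ g (D t) + 2 * (‖l 0 - N t‖ * (C t * ‖D t‖))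
    + t * (C t * ‖D t‖) ^ 2
  have hN0 : N 0 = l 0 := Nint_self e (l 0)
  have hNc : ContinuousAt N 0 := (Nint_cont e (hsT e (l 0)) (l 0)).continuousAt.comp hcont
  have hCc : ContinuousAt C 0 := by
    have : ContinuousAt (fun t => ‖hsT e (l t)‖) 0 := hcont.norm
    exact (continuousAt_const.add this).rexp
  have hf : ContinuousAt f 0 := by
    have h1 : ContinuousAt (fun t => inner ℝ g (D t)) 0 := Filter.Tendsto.inner tendsto_const_nhds hD
    have h2 : ContinuousAt (fun t => ‖l 0 - N t‖) 0 := (continuousAt_const.sub hNc).norm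
    have h3 : ContinuousAt (fun t => C t * ‖D t‖) 0 := hCc.mul hD.norm
    exact ((continuousAt_const.mul h1).add (continuousAt_const.mul (h2.mul h3))).add
      (continuousAt_id.mul (h3.pow 2))
  have hf0 : f 0 = 2 * inner ℝ g (D 0) := by
    simp only [f, hN0]; simp
  have hpos : ∀ t, 0 < t → 0 ≤ f t := by
    intro t ht
    have h1 : ‖l t‖ ^ 2 = ‖l 0‖ ^ 2 + 2 * inner ℝ (l 0) (l t - l 0) + ‖l t - l 0‖ ^ 2 := by
      rw [← norm_add_sq_real, add_sub_cancel]
    have h2 : ‖l 0‖ ^ 2 ≤ ‖l t‖ ^ 2 := pow_le_pow_left₀ (norm_nonneg _) (hmin t) 2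
    have h3 : inner ℝ (N t) (l t - l 0) = t * inner ℝ g (D t) := by
      rw [← Nint_inner e (hsa 0) (hsa t), hDuh, real_inner_smul_right]
    have h4 : inner ℝ (l 0) (l t - l 0) = inner ℝ (N t) (l t - l 0)
      + inner ℝ (l 0 - N t) (l t - l 0) := by rw [← inner_add_left, add_sub_cancel]
    have h5 : inner ℝ (l 0 - N t) (l t - l 0) ≤ ‖l 0 - N t‖ * (C t * (t * ‖D t‖)) :=
      (real_inner_le_norm _ _).trans (mul_le_mul_of_nonneg_left (hΔ t ht.le) (norm_nonneg _))
    have h6 : ‖l t - l 0‖ ^ 2 ≤ (C t * (t * ‖D t‖)) ^ 2 :=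
      pow_le_pow_left₀ (norm_nonneg _) (hΔ t ht.le) 2
    have h7 : 0 ≤ t * f t := by
      have : t * f t = 2 * (t * inner ℝ g (D t)) + 2 * (‖l 0 - N t‖ * (C t * (t * ‖D t‖)))
        + (C t * (t * ‖D t‖)) ^ 2 := by simp only [f]; ring
      rw [this]
      linarith
    exact nonneg_of_mul_nonneg_right h7 ht
  have hlim : Filter.Tendsto f (nhdsWithin 0 (Set.Ioi 0)) (nhds (f 0)) :=
    hf.tendsto.mono_left nhdsWithin_le_nhds
  have := ge_of_tendsto hlim (b := 0) (by
    filter_upwards [self_mem_nhdsWithin] with t ht using hpos t ht)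
  rw [hf0] at this
  linarith

section abstractExp

variable {V : Type*} [NormedAddCommGroup V] [NormedSpace ℝ V] [CompleteSpace V]

lemma exp_apply_hasSum (T : V →L[ℝ] V) (z : V) :
    HasSum (fun n : ℕ => ((Nat.factorial n : ℝ))⁻¹ • (T ^ n) z) (NormedSpace.exp T z) := by
  have h := NormedSpace.exp_series_hasSum_exp' (𝕂 := ℝ) T
  exact h.mapL (ContinuousLinearMap.apply ℝ V z)

lemma cosh_mem (T : V →L[ℝ] V) (M : Submodule ℝ V) (hM : IsClosed (M : Set V))
    (hT : ∀ z ∈ M, T (T z) ∈ M) (z : V) (hz : z ∈ M) :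
    NormedSpace.exp T z + NormedSpace.exp (-T) z ∈ M := by
  have h := (exp_apply_hasSum T z).add (exp_apply_hasSum (-T) z)
  have hev : ∀ m : ℕ, (T ^ (m + m)) z ∈ M := by
    intro m
    induction m with
    | zero => simpa using hz
    | succ m ih =>
      have : (T ^ (m + 1 + (m + 1))) z = T (T ((T ^ (m + m)) z)) := by
        rw [show m + 1 + (m + 1) = (m + m) + 1 + 1 by ring, pow_succ', pow_succ']
        rfl
      rw [this]
      exact hT _ ih
  refine hM.mem_of_tendsto h (Filter.Eventually.of_forall fun s => M.sum_mem fun n _ => ?_)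
  rw [← smul_add]
  apply M.smul_mem
  rcases Nat.even_or_odd n with hn | hn
  · obtain ⟨m, rfl⟩ := id hn
    rw [hn.neg_pow]
    exact M.add_mem (hev m) (hev m)
  · rw [hn.neg_pow]
    simp
end abstractExp

/-- left multiplication as ring hom -/
def LmHom (e : HilbertBasis ι ℂ H) : (H →L[ℂ] H) →+* (HSV ι H →L[ℝ] HSV ι H) where
  toFun A := Lm e A
  map_one' := ContinuousLinearMap.ext fun v => Lm_one e v
  map_mul' A B := ContinuousLinearMap.ext fun v => Lm_mul e A B v
  map_zero' := map_zero _
  map_add' A B := map_add _ A B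

/-- right multiplication as ring hom -/
def RmHom (e : HilbertBasis ι ℂ H) : (H →L[ℂ] H)ᵐᵒᵖ →+* (HSV ι H →L[ℝ] HSV ι H) where
  toFun A := Rm e A.unop
  map_one' := ContinuousLinearMap.ext fun v => Rm_one e v
  map_mul' A B := ContinuousLinearMap.ext fun v => Rm_mul e B.unop A.unop v
  map_zero' := map_zero (Rm e)
  map_add' A B := map_add (Rm e) A.unop B.unop

lemma Lm_exp (e : HilbertBasis ι ℂ H) (A : H →L[ℂ] H) :
    Lm e (NormedSpace.exp A) = NormedSpace.exp (Lm e A) := by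
  let _ : NormedAlgebra ℚ (H →L[ℂ] H) := NormedAlgebra.restrictScalars ℚ ℂ _
  let _ : NormedAlgebra ℚ (HSV ι H →L[ℝ] HSV ι H) := NormedAlgebra.restrictScalars ℚ ℝ _
  exact NormedSpace.map_exp (LmHom e) (Lm e).continuous A

lemma Rm_exp (e : HilbertBasis ι ℂ H) (A : H →L[ℂ] H) :
    Rm e (NormedSpace.exp A) = NormedSpace.exp (Rm e A) := by
  let _ : NormedAlgebra ℚ (H →L[ℂ] H) := NormedAlgebra.restrictScalars ℚ ℂ _
  let _ : NormedAlgebra ℚ (HSV ι H →L[ℝ] HSV ι H) := NormedAlgebra.restrictScalars ℚ ℝ _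
  have h := NormedSpace.map_exp (RmHom e)
    ((Rm e).continuous.comp MulOpposite.continuous_unop) (MulOpposite.op A)
  rw [NormedSpace.exp_op] at h
  exact h

/-- the conjugation action -/
def rho (e : HilbertBasis ι ℂ H) (X : H →L[ℂ] H) (s : ℝ) (z : HSV ι H) : HSV ι H :=
  Lm e (NormedSpace.exp (s • X)) (Rm e (NormedSpace.exp ((-s) • X)) z)

lemma rho_eq (e : HilbertBasis ι ℂ H) (X : H →L[ℂ] H) (s : ℝ) (z : HSV ι H) :
    rho e X s z = NormedSpace.exp (s • (Lm e X - Rm e X)) z := by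
  have hc : Commute (s • Lm e X) ((-s) • Rm e X) := by
    apply Commute.smul_left
    apply Commute.smul_right
    exact ContinuousLinearMap.ext fun v => Lm_Rm e X X v
  have : s • (Lm e X - Rm e X) = s • Lm e X + (-s) • Rm e X := by
    rw [smul_sub, neg_smul, sub_eq_add_neg]
  rw [this, aexp_add hc, ← map_smul, ← map_smul, ← Lm_exp, ← Rm_exp]
  rfl

lemma rho_symm_mem (e : HilbertBasis ι ℂ H) (X : H →L[ℂ] H) (M : Submodule ℝ (HSV ι H))
    (hM : IsClosed (M : Set (HSV ι H)))
    (hX : ∀ z ∈ M, (Lm e X - Rm e X) ((Lm e X - Rm e X) z) ∈ M) (s : ℝ) (z : HSV ι H)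
    (hz : z ∈ M) : rho e X s z + rho e X (-s) z ∈ M := by
  rw [rho_eq, rho_eq, neg_smul]
  refine cosh_mem _ M hM (fun z hz => ?_) z hz
  rw [smul_apply, smul_apply, map_smul]
  exact M.smul_mem _ (M.smul_mem _ (hX z hz))

lemma rho_inner (e : HilbertBasis ι ℂ H) {X : H →L[ℂ] H} (hX : IsSelfAdjoint X) (a b : ℝ)
    (z w : HSV ι H) : inner ℝ (rho e X a z) (rho e X b w) = inner ℝ z (rho e X (a + b) w) := by
  unfold rho
  rw [inner_Lm, inner_Rm, exp_smul_sa hX, exp_smul_sa hX, ← Lm_mul, ← Lm_Rm, ← Rm_mul,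
    op_exp_smul_mul, op_exp_smul_mul]
  congr 6
  ring_nf

lemma rho_zero (e : HilbertBasis ι ℂ H) (X : H →L[ℂ] H) (z : HSV ι H) : rho e X 0 z = z := by
  unfold rho
  simp [Lm_one, Rm_one]

lemma rho_sum_ge (e : HilbertBasis ι ℂ H) {X : H →L[ℂ] H} (hX : IsSelfAdjoint X) (s : ℝ)
    (z : HSV ι H) : 2 * ‖z‖ ^ 2 ≤ inner ℝ z (rho e X s z) + inner ℝ z (rho e X (-s) z) := by
  have h1 : inner ℝ (rho e X (s/2) z) (rho e X (s/2) z) = inner ℝ z (rho e X s z) := by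
    rw [rho_inner e hX, add_halves]
  have h2 : inner ℝ (rho e X (-(s/2)) z) (rho e X (-(s/2)) z) = inner ℝ z (rho e X (-s) z) := by
    rw [rho_inner e hX]; congr 2; ring
  have h3 : inner ℝ (rho e X (s/2) z) (rho e X (-(s/2)) z) = ‖z‖ ^ 2 := by
    rw [rho_inner e hX, add_neg_cancel, rho_zero, real_inner_self_eq_norm_sq]
  have h4 := real_inner_self_nonneg (x := rho e X (s/2) z - rho e X (-(s/2)) z)
  rw [real_inner_sub_sub_self, h1, h2, h3] at h4
  linarith

lemma rho_cont (e : HilbertBasis ι ℂ H) (X : H →L[ℂ] H) (z : HSV ι H) :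
    Continuous fun s => rho e X s z := by
  unfold rho
  have := cont_exp (H := H)
  fun_prop

lemma rho_integral_ge (e : HilbertBasis ι ℂ H) {X : H →L[ℂ] H} (hXs : IsSelfAdjoint X)
    (M : Submodule ℝ (HSV ι H)) (hM : IsClosed (M : Set (HSV ι H)))
    (hX : ∀ z ∈ M, (Lm e X - Rm e X) ((Lm e X - Rm e X) z) ∈ M)
    (k z : HSV ι H) (hz : z ∈ M) (hk : ∀ w ∈ M, inner ℝ (k - z) w = 0) :
    ‖z‖ ^ 2 ≤ ∫ s in (0:ℝ)..1, inner ℝ k (rho e X (1/2 - s) z) := by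
  have hr := rho_cont e X z
  have hkr : Continuous fun s : ℝ => inner ℝ k (rho e X (1/2 - s) z) :=
    continuous_const.inner (hr.comp (continuous_const.sub continuous_id))
  have hkr2 : Continuous fun s : ℝ => inner ℝ k (rho e X (-(1/2 - s)) z) :=
    continuous_const.inner (hr.comp (continuous_const.sub continuous_id).neg)
  have hsym : ∫ s in (0:ℝ)..1, inner ℝ k (rho e X (1/2 - s) z)
      = ∫ s in (0:ℝ)..1, inner ℝ k (rho e X (-(1/2 - s)) z) := by
    have := intervalIntegral.integral_comp_sub_left (a := 0) (b := 1)
      (fun s => inner ℝ k (rho e X (1/2 - s) z)) 1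
    simp only [sub_self, sub_zero] at this
    rw [← this]
    congr 1
    funext s
    congr 2
    ring
  have h2 : 2 * ‖z‖ ^ 2 ≤ ∫ s in (0:ℝ)..1,
      (inner ℝ k (rho e X (1/2 - s) z) + inner ℝ k (rho e X (-(1/2 - s)) z)) := by
    have hc : 2 * ‖z‖ ^ 2 = ∫ _ in (0:ℝ)..1, 2 * ‖z‖ ^ 2 := by simp
    rw [hc]
    refine intervalIntegral.integral_mono_on zero_le_one (by simp)
      ((hkr.add hkr2).intervalIntegrable _ _) fun s _ => ?_
    have h3 := hk _ (rho_symm_mem e X M hM hX (1/2 - s) z hz)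
    have h4 := rho_sum_ge e hXs (1/2 - s) z
    rw [inner_sub_left, inner_add_right, inner_add_right] at h3
    linarith
  rw [intervalIntegral.integral_add (hkr.intervalIntegrable _ _) (hkr2.intervalIntegrable _ _),
    ← hsym] at h2
  linarith

lemma exp_conj' (v w x : H →L[ℂ] H) (h1 : v * w = 1) (h2 : w * v = 1) :
    NormedSpace.exp (v * x * w) = v * NormedSpace.exp x * w := by
  let _ : NormedAlgebra ℚ (H →L[ℂ] H) := NormedAlgebra.restrictScalars ℚ ℂ _
  exact NormedSpace.exp_units_conj (⟨v, w, h1, h2⟩ : (H →L[ℂ] H)ˣ) x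

lemma exp_smul_one (x : H →L[ℂ] H) : NormedSpace.exp ((1:ℝ) • x) = NormedSpace.exp x := by
  rw [one_smul]

lemma log_conj {X P L K : H →L[ℂ] H} (hX : IsSelfAdjoint X) (hP : IsSelfAdjoint P)
    (hL : IsSelfAdjoint L) (hK : IsSelfAdjoint K)
    (hLe : NormedSpace.exp L = NormedSpace.exp (-(1/2:ℝ) • P) * NormedSpace.exp X
      * NormedSpace.exp (-(1/2:ℝ) • P))
    (hKe : NormedSpace.exp K = NormedSpace.exp (-(1/2:ℝ) • X) * NormedSpace.exp P
      * NormedSpace.exp (-(1/2:ℝ) • X)) :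
    NormedSpace.exp (-(1/2:ℝ) • P) * (NormedSpace.exp ((-1:ℝ) • L) * L)
      * NormedSpace.exp (-(1/2:ℝ) • P)
    = -(NormedSpace.exp (-(1/2:ℝ) • X) * K * NormedSpace.exp (-(1/2:ℝ) • X)) := by
  have hhalf : ∀ (Y : H →L[ℂ] H) (a b : ℝ), a + b = 0 →
      NormedSpace.exp (a • Y) * NormedSpace.exp (b • Y) = 1 := by
    intro Y a b h
    rw [op_exp_smul_mul, h, zero_smul, NormedSpace.exp_zero]
  have hsum : ∀ (Y : H →L[ℂ] H) (a b c : ℝ), a + b = c →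
      NormedSpace.exp (a • Y) * NormedSpace.exp (b • Y) = NormedSpace.exp (c • Y) := by
    intro Y a b c h
    rw [op_exp_smul_mul, h]
  set a := NormedSpace.exp (-(1/2:ℝ) • P) with ha
  set b := NormedSpace.exp (-(1/2:ℝ) • X) with hb
  set c := NormedSpace.exp ((1/2:ℝ) • X) with hc
  set d := NormedSpace.exp ((1/2:ℝ) • P) with hd
  set m := NormedSpace.exp (-(1/2:ℝ) • L) with hm
  have hcc : c * c = NormedSpace.exp X := by
    rw [hc, hsum X _ _ 1 (by norm_num), exp_smul_one]
  have hmm : m * m = NormedSpace.exp ((-1:ℝ) • L) := hsum L _ _ _ (by norm_num)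
  have hmL : m * (NormedSpace.exp L) * m = 1 := by
    rw [← exp_smul_one L, hm, hsum L _ _ (1/2) (by norm_num), hhalf L _ _ (by norm_num)]
  have hbc : b * c = 1 := hhalf X _ _ (by norm_num)
  have hcb : c * b = 1 := hhalf X _ _ (by norm_num)
  have had : a * d = 1 := hhalf P _ _ (by norm_num)
  have hda : d * a = 1 := hhalf P _ _ (by norm_num)
  have hdd : d * d = NormedSpace.exp P := by
    rw [hd, hsum P _ _ 1 (by norm_num), exp_smul_one]
  have sa : star a = a := exp_smul_sa hP _
  have sc : star c = c := exp_smul_sa hX _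
  have sm : star m = m := exp_smul_sa hL _
  set v := c * a * m with hv
  have sv : star v = m * (a * c) := by rw [hv, star_mul, star_mul, sa, sc, sm]
  have hvv : star v * v = 1 := by
    rw [sv, hv]
    calc m * (a * c) * (c * a * m) = m * (a * (c * c) * a) * m := by simp only [mul_assoc]
      _ = 1 := by rw [hcc, ← hLe, hmL]
  have huv : IsUnit v := by
    rw [hv]
    exact ((exp_unit _).mul (exp_unit _)).mul (exp_unit _)
  have hvv' : v * star v = 1 := by
    obtain ⟨u, hu⟩ := huv
    have : star v = ↑u⁻¹ := by
      calc star v = star v * (u * ↑u⁻¹) := by simp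
        _ = (star v * v) * ↑u⁻¹ := by rw [← mul_assoc, hu]
        _ = ↑u⁻¹ := by rw [hvv, one_mul]
    rw [this, ← hu]; simp
  have hKinv : NormedSpace.exp (-K) = c * (a * a) * c := by
    have h1 : NormedSpace.exp K * (c * (a * a) * c) = 1 := by
      rw [hKe, ← hdd]
      calc b * (d * d) * b * (c * (a * a) * c) = b * (d * (d * (b * c) * a) * a) * c := by
            simp only [mul_assoc]
        _ = 1 := by rw [hbc, mul_one, hda, mul_one, hda, mul_one, hbc]
    have h2 : NormedSpace.exp (-K) * NormedSpace.exp K = 1 := by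
      have := hhalf K (-1) 1 (by norm_num)
      rwa [exp_smul_one, neg_one_smul] at this
    calc NormedSpace.exp (-K) = NormedSpace.exp (-K) * (NormedSpace.exp K * (c * (a * a) * c)) := by
          rw [h1, mul_one]
      _ = _ := by rw [← mul_assoc, h2, one_mul]
  have hexp : NormedSpace.exp (v * L * star v) = NormedSpace.exp (-K) := by
    rw [exp_conj' v (star v) L hvv' hvv, hKinv, sv, hv]
    calc c * a * m * NormedSpace.exp L * (m * (a * c))
        = c * a * (m * NormedSpace.exp L * m) * (a * c) := by simp only [mul_assoc]
      _ = c * (a * a) * c := by rw [hmL]; simp only [mul_assoc, one_mul]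
  have hlog : v * L * star v = -K := by
    have h1 : IsSelfAdjoint (v * L * star v) := hL.conjugate v
    rw [← plog_exp h1, hexp, plog_exp hK.neg]
  have hcommL : L * m = m * L := op_exp_comm L _
  rw [← hmm]
  calc a * (m * m * L) * a = (b * c) * (a * (m * (m * L)) * a) * (c * b) := by
        rw [hbc, hcb, one_mul, mul_one, mul_assoc m m L]
    _ = b * (v * L * star v) * b := by
        rw [← hcommL, sv, hv]; simp only [mul_assoc]
    _ = -(b * K * b) := by rw [hlog, mul_neg, neg_mul]

lemma conj_exp_sub_one_isHS {e : HilbertBasis ι ℂ H} {P Y : H →L[ℂ] H} (hP : IsHS e P)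
    (hY : IsHS e Y) : IsHS e (NormedSpace.exp (-(1/2:ℝ) • P) * NormedSpace.exp Y *
      NormedSpace.exp (-(1/2:ℝ) • P) - 1) := by
  have h1 : NormedSpace.exp (-(1/2:ℝ) • P) * NormedSpace.exp P *
      NormedSpace.exp (-(1/2:ℝ) • P) = 1 := by
    rw [← exp_smul_one P, op_exp_smul_mul, op_exp_smul_mul]
    norm_num
  have h2 : NormedSpace.exp (-(1/2:ℝ) • P) * NormedSpace.exp Y *
      NormedSpace.exp (-(1/2:ℝ) • P) - 1 = NormedSpace.exp (-(1/2:ℝ) • P) *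
      ((NormedSpace.exp Y - 1) - (NormedSpace.exp P - 1)) * NormedSpace.exp (-(1/2:ℝ) • P) := by
    rw [sub_sub_sub_cancel_right, mul_sub, sub_mul, h1]
  rw [h2]
  exact (((exp_sub_one_isHS hY).sub (exp_sub_one_isHS hP)).mul_left _).mul_right _

lemma conj_exp_sp {P Y : H →L[ℂ] H} (hP : IsSelfAdjoint P)
    (hY : IsSelfAdjoint Y) : IsStrictlyPositive (NormedSpace.exp (-(1/2:ℝ) • P) *
      NormedSpace.exp Y * NormedSpace.exp (-(1/2:ℝ) • P)) :=
  conj_strictlyPositive (exp_strictlyPositive hY) (exp_unit _) (exp_smul_sa hP _)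

lemma comap_closed (e : HilbertBasis ι ℂ H) (E : Submodule ℝ (H →L[ℂ] H))
    (hE : ∀ X ∈ E, MemS2 e X) (hclosed : IsHSClosed e (E : Set (H →L[ℂ] H))) :
    IsClosed ((E.comap (hsT e).toLinearMap : Submodule ℝ (HSV ι H)) : Set (HSV ι H)) := by
  apply isClosed_of_closure_subset
  intro v hv
  have hsa : IsSelfAdjoint (hsT e v) := by
    have hcl : IsClosed {v : HSV ι H | star (hsT e v) = hsT e v} :=
      isClosed_eq (hsT e).continuous.star (hsT e).continuous
    have hsub : ((E.comap (hsT e).toLinearMap : Submodule ℝ (HSV ι H)) : Set (HSV ι H)) ⊆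
        {v : HSV ι H | star (hsT e v) = hsT e v} := fun w hw => (hE (hsT e w) hw).1
    exact closure_minimal hsub hcl hv
  refine hclosed (hsT e v) ⟨hsa, hsT_isHS e v⟩ fun ε hε => ?_
  obtain ⟨w, hw, hd⟩ := Metric.mem_closure_iff.1 hv ε hε
  refine ⟨hsT e w, hw, ?_⟩
  rwa [← map_sub, hsNorm_hsT, ← dist_eq_norm]

lemma plog_cont {Y : ℝ → (H →L[ℂ] H)} (hY : Continuous Y)
    (hs : ∀ t, IsStrictlyPositive (Y t)) : Continuous fun t => plog (Y t) :=
  CFC.continuousOn_log.comp_continuous hY fun t => ⟨(hs t).isSelfAdjoint, (hs t).isUnit⟩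

lemma first_order (e : HilbertBasis ι ℂ H) {P X : H →L[ℂ] H} (hP : IsSelfAdjoint P)
    (hPh : IsHS e P) (hX : IsSelfAdjoint X) (hXh : IsHS e X) (z : HSV ι H)
    (hz : IsSelfAdjoint (hsT e z)) (k : HSV ι H)
    (hk : hsT e k = plog (NormedSpace.exp (-(1/2:ℝ) • X) * NormedSpace.exp P *
      NormedSpace.exp (-(1/2:ℝ) • X)))
    (hmin : ∀ t : ℝ, gdist e (NormedSpace.exp P) (NormedSpace.exp X) ≤
      gdist e (NormedSpace.exp P) (NormedSpace.exp (X + t • hsT e z))) :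
    ∫ s in (0:ℝ)..1, inner ℝ k (rho e X (1/2 - s) z) ≤ 0 := by
  set a := NormedSpace.exp (-(1/2:ℝ) • P) with ha
  set b := NormedSpace.exp (-(1/2:ℝ) • X) with hb
  have sa : star a = a := exp_smul_sa hP _
  have sb : star b = b := exp_smul_sa hX _
  have hYs : ∀ t : ℝ, IsSelfAdjoint (X + t • hsT e z) := fun t =>
    hX.add ((IsSelfAdjoint.all t).smul hz)
  have hYh : ∀ t : ℝ, IsHS e (X + t • hsT e z) := fun t => hXh.add ((hsT_isHS e z).smul t)
  have hsp : ∀ t : ℝ, IsStrictlyPositive (a * NormedSpace.exp (X + t • hsT e z) * a) :=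
    fun t => conj_exp_sp hP (hYs t)
  have hLh : ∀ t : ℝ, IsHS e (plog (a * NormedSpace.exp (X + t • hsT e z) * a)) := fun t =>
    plog_isHS (hsp t) (conj_exp_sub_one_isHS hPh (hYh t))
  let l : ℝ → HSV ι H := fun t => toV e _ (hLh t)
  have hl : ∀ t, hsT e (l t) = plog (a * NormedSpace.exp (X + t • hsT e z) * a) := fun t =>
    hsT_toV e _ (hLh t)
  have hle : ∀ t, NormedSpace.exp (hsT e (l t)) = a * NormedSpace.exp (X + t • hsT e z) * a :=
    fun t => by rw [hl, exp_plog (hsp t)]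
  have hYc : Continuous fun t : ℝ => X + t • hsT e z := by fun_prop
  have hDc := Duh_cont e X _ hYc z
  have hX0 : X + (0:ℝ) • hsT e z = X := by rw [zero_smul, add_zero]
  have hgd : ∀ t, gdist e (NormedSpace.exp P) (NormedSpace.exp (X + t • hsT e z)) = ‖l t‖ := by
    intro t
    unfold gdist
    rw [pinvsqrt_exp hP]
    exact (norm_toV e _ (hLh t)).symm
  have hvar := variation e l (fun t => by rw [hl]; exact plog_sa _)
    (by
      have hc := cont_exp (H := H)
      have : Continuous fun t : ℝ => a * NormedSpace.exp (X + t • hsT e z) * a := by fun_prop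
      have h2 := plog_cont this hsp
      simp only [hl]
      exact h2.continuousAt)
    (fun t => Lm e a (Rm e a (Duh e X (X + t • hsT e z) z)))
    (by
      exact ((Lm e a).continuous.comp ((Rm e a).continuous.comp hDc)).continuousAt)
    (by
      intro t
      have h1 := hsT_Duh e X (X + t • hsT e z) (t • z) (by rw [map_smul, add_sub_cancel_left])
      rw [Duh_smul, map_smul] at h1
      rw [hle, hle, hX0, hsT_Lm, hsT_Rm, ← sub_mul, ← mul_sub, ← h1, mul_smul_comm,
        smul_mul_assoc, mul_assoc])
    (by
      intro t
      rw [← hgd, ← hgd, hX0]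
      exact hmin t)
  have hK := plog_sa (b * NormedSpace.exp P * b)
  rw [← hk] at hK
  have hKe : NormedSpace.exp (hsT e k) = b * NormedSpace.exp P * b := by
    rw [hk, exp_plog (conj_exp_sp hX hP)]
  have hL0 : IsSelfAdjoint (hsT e (l 0)) := by rw [hl]; exact plog_sa _
  have hle0 := hle 0
  rw [hX0] at hle0
  have hconj := log_conj hX hP hL0 hK hle0 hKe
  have hvec : Rm e a (Lm e a (Lm e (NormedSpace.exp ((-1 : ℝ) • hsT e (l 0))) (l 0)))
      = -(Rm e b (Lm e b k)) := by
    apply hsT_inj e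
    rw [map_neg]
    simp only [hsT_Rm, hsT_Lm]
    exact hconj
  rw [hX0, real_inner_comm, inner_Lm, inner_Rm, sa, hvec, inner_neg_right] at hvar
  have hfin : inner ℝ (Duh e X X z) (Rm e b (Lm e b k)) =
      ∫ s in (0:ℝ)..1, inner ℝ k (rho e X (1/2 - s) z) := by
    have h1 := (innerSL ℝ (Rm e b (Lm e b k))).intervalIntegral_comp_comm
      ((Duh_cont_integrand e X X z).intervalIntegrable (μ := MeasureTheory.volume) 0 1)
    simp only [innerSL_apply_apply] at h1
    rw [real_inner_comm]
    unfold Duh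
    rw [← h1]
    congr 1
    funext s
    rw [inner_Rm, inner_Lm, sb, ← Lm_Rm, ← Lm_mul, ← Rm_mul, hb, op_exp_smul_mul,
      op_exp_smul_mul]
    unfold rho
    rw [show -(1/2:ℝ) + (1 - s) = 1/2 - s by ring, show s + -(1/2:ℝ) = -(1/2 - s) by ring]
  rw [hfin] at hvar
  linarith

/-- If `q ∈ exp E` is a nearest point to `p ∈ P` in `exp E`, then
`q^{-1/2} p q^{-1/2} ∈ exp F` where `F = E^⊥` in `S₂(H)`: the geodesic from `p` to
its projection meets `exp E` orthogonally. -/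
theorem statement14 (e : HilbertBasis ι ℂ H) (E : Submodule ℝ (H →L[ℂ] H))
    (hE : ∀ X ∈ E, MemS2 e X) (hclosed : IsHSClosed e (E : Set (H →L[ℂ] H)))
    (hbrk : ∀ X ∈ E, ∀ Y ∈ E, brk X (brk X Y) ∈ E)
    (p q : H →L[ℂ] H) (hp : MemP e p) (hq : q ∈ expSet (E : Set (H →L[ℂ] H)))
    (hmin : gdist e p q = sInf (gdist e p '' expSet (E : Set (H →L[ℂ] H)))) :
    pinvsqrt q * p * pinvsqrt q ∈ expSet (hsPerp e (E : Set (H →L[ℂ] H))) := by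
  obtain ⟨X, hXE, rfl⟩ := hq
  have hXE' : X ∈ E := hXE
  obtain ⟨hX, hXh⟩ := hE X hXE'
  have hpsp := hp.strictlyPositive
  have hPh : IsHS e (plog p) := plog_isHS hpsp hp.2.2.2
  have hP : IsSelfAdjoint (plog p) := plog_sa p
  have hpe : NormedSpace.exp (plog p) = p := exp_plog hpsp
  generalize plog p = P at hPh hP hpe
  subst hpe
  rw [pinvsqrt_exp hX]
  have hsp := conj_exp_sp hX hP
  have hKh := plog_isHS hsp (conj_exp_sub_one_isHS hXh hPh)
  refine ⟨plog (NormedSpace.exp (-(1/2:ℝ) • X) * NormedSpace.exp P *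
      NormedSpace.exp (-(1/2:ℝ) • X)), ⟨⟨plog_sa _, hKh⟩, ?_⟩, exp_plog hsp⟩
  set k := toV e _ hKh with hkdef
  have hk : hsT e k = _ := hsT_toV e _ hKh
  rw [← hk]
  set M : Submodule ℝ (HSV ι H) := E.comap (hsT e).toLinearMap with hMdef
  have hM : IsClosed (M : Set (HSV ι H)) := comap_closed e E hE hclosed
  have : CompleteSpace M := hM.completeSpace_coe
  set z := M.starProjection k with hzdef
  have hzM : z ∈ M := M.starProjection_apply_mem k
  have hzE : hsT e z ∈ E := hzM
  have hkz : ∀ w ∈ M, inner ℝ (k - z) w = 0 :=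
    (Submodule.mem_orthogonal' _ _).1 (M.sub_starProjection_mem_orthogonal k)
  have hMX : ∀ z ∈ M, (Lm e X - Rm e X) ((Lm e X - Rm e X) z) ∈ M := by
    intro w hw
    have hw' : hsT e w ∈ E := hw
    have h1 : ∀ y, hsT e ((Lm e X - Rm e X) y) = brk X (hsT e y) := by
      intro y
      rw [sub_apply, map_sub, hsT_Lm, hsT_Rm]
      rfl
    change hsT e _ ∈ E
    rw [h1, h1]
    exact hbrk X hXE' _ hw'
  have hge := rho_integral_ge e hX M hM hMX k z hzM hkz
  have hle := first_order e hP hPh hX hXh z (hE _ hzE).1 k hk (by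
    intro t
    rw [hmin]
    refine csInf_le ⟨0, ?_⟩ ⟨_, ⟨X + t • hsT e z, E.add_mem hXE' (E.smul_mem t hzE), rfl⟩, rfl⟩
    rintro _ ⟨y, -, rfl⟩
    exact Real.sqrt_nonneg _)
  have hz0 : z = 0 := by
    have : ‖z‖ ^ 2 = 0 := le_antisymm (hge.trans hle) (sq_nonneg _)
    simpa using this
  intro Y hY
  have hY' : Y ∈ E := hY
  have hYv := hsT_toV e Y (hE Y hY').2
  rw [← hYv, hsInner_hsT, real_inner_comm]
  have := hkz (toV e Y (hE Y hY').2) (by change hsT e _ ∈ E; rw [hYv]; exact hY')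
  rwa [hz0, sub_zero] at this
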